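/- (Future geodesic completeness of Gowdy spacetimes, smooth areal-coordinate version.) Let K > 0, J_X, J_Y ∈ ℝ, s₀ < s₁ ≤ +∞, and let ξ = (ξ^R, ξ^θ, ξ^X, ξ^Y) : [s₀,s₁) → ℝ⁴ be a C² curve with ξ^R(s) ≥ R₀ for all s and ξ̇^R(s₀) > 0, satisfying for all s ∈ [s₀,s₁): (i) e^{2ρ(ξ^R,ξ^θ)} ( −(ξ̇^R)² + (ξ̇^θ)² ) + e^{2U(ξ^R,ξ^θ)} ( ξ̇^X + A(ξ^R,ξ^θ) ξ̇^Y )² + e^{−2U(ξ^R,ξ^θ)} (ξ^R)² (ξ̇^Y)² = −K²; (ii) e^{2U(ξ^R,ξ^θ)} ( ξ̇^X + A(ξ^R,ξ^θ) ξ̇^Y ) = J_X; (iii) A(ξ^R,ξ^θ) e^{2U(ξ^R,ξ^θ)} ( ξ̇^X + A(ξ^R,ξ^θ) ξ̇^Y ) + e^{−2U(ξ^R,ξ^θ)} (ξ^R)² ξ̇^Y = J_Y; (iv) ξ̈^θ = −(∂_θ ρ)(ξ^R,ξ^θ) ((ξ̇^R)² + (ξ̇^θ)²) − 2 (∂_R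 ρ)(ξ^R,ξ^θ) ξ̇^R ξ̇^θ + (1/2) e^{−2ρ(ξ^R,ξ^θ)} [ ∂_θ(e^{2U}) (ξ̇^X)² + 2 ∂_θ(A e^{2U}) ξ̇^X ξ̇^Y + ∂_θ(A² e^{2U} + R² e^{−2U}) (ξ̇^Y)² ](ξ^R,ξ^θ). Assume moreover that ξ is inextendible: there is no s₁' > s₁ and C² curve on [s₀,s₁') with values in [R₀,∞) × ℝ³ satisfying (i)–(iv) and extending ξ. Then s₁ = +∞. -/

import Mathlib

open Real MeasureTheory Set

/-- Partial derivative with respect to the first (time) variable `R`. -/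
noncomputable def pdR (f : ℝ → ℝ → ℝ) (R θ : ℝ) : ℝ := deriv (fun r => f r θ) R

/-- Partial derivative with respect to the second (space) variable `θ`. -/
noncomputable def pdT (f : ℝ → ℝ → ℝ) (R θ : ℝ) : ℝ := deriv (fun t => f R t) θ

/-- `ξ = (ξR, ξθ, ξX, ξY)` is a future-directed timelike geodesic of the Gowdy
metric `g = e^{2(η−U)}(−dR² + dθ²) + e^{2U}(dx + A dy)² + e^{−2U}R² dy²`
on `[s₀, s₁)`, parametrized so that `g(ξ̇,ξ̇) = −K²`, written using the
conservation of `g(ξ̇,ξ̇)` (i) and of the angular momenta `g(ξ̇,X)` (ii),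
`g(ξ̇,Y)` (iii), together with the `θ`-component of the geodesic equation (iv). -/
def IsGowdyGeodesic (R₀ : ℝ) (U A η : ℝ → ℝ → ℝ) (K JX JY : ℝ)
    (s₀ s₁ : ℝ) (ξR ξθ ξX ξY : ℝ → ℝ) : Prop :=
  ContDiffOn ℝ 2 ξR (Set.Ico s₀ s₁) ∧ ContDiffOn ℝ 2 ξθ (Set.Ico s₀ s₁) ∧
  ContDiffOn ℝ 2 ξX (Set.Ico s₀ s₁) ∧ ContDiffOn ℝ 2 ξY (Set.Ico s₀ s₁) ∧
  (∀ s ∈ Set.Ico s₀ s₁, R₀ ≤ ξR s) ∧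
  -- (i) constancy of the Lorentzian norm: g(ξ̇,ξ̇) = −K²
  (∀ s ∈ Set.Ico s₀ s₁,
    Real.exp (2 * (η (ξR s) (ξθ s) - U (ξR s) (ξθ s)))
        * (-(derivWithin ξR (Set.Ico s₀ s₁) s) ^ 2
            + (derivWithin ξθ (Set.Ico s₀ s₁) s) ^ 2)
      + Real.exp (2 * U (ξR s) (ξθ s))
        * (derivWithin ξX (Set.Ico s₀ s₁) s
            + A (ξR s) (ξθ s) * derivWithin ξY (Set.Ico s₀ s₁) s) ^ 2
      + Real.exp (-(2 * U (ξR s) (ξθ s))) * (ξR s) ^ 2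
        * (derivWithin ξY (Set.Ico s₀ s₁) s) ^ 2 = -K ^ 2) ∧
  -- (ii) conservation of the angular momentum J_X = g(ξ̇,X)
  (∀ s ∈ Set.Ico s₀ s₁,
    Real.exp (2 * U (ξR s) (ξθ s))
      * (derivWithin ξX (Set.Ico s₀ s₁) s
          + A (ξR s) (ξθ s) * derivWithin ξY (Set.Ico s₀ s₁) s) = JX) ∧
  -- (iii) conservation of the angular momentum J_Y = g(ξ̇,Y)
  (∀ s ∈ Set.Ico s₀ s₁,
    A (ξR s) (ξθ s) * Real.exp (2 * U (ξR s) (ξθ s))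
        * (derivWithin ξX (Set.Ico s₀ s₁) s
            + A (ξR s) (ξθ s) * derivWithin ξY (Set.Ico s₀ s₁) s)
      + Real.exp (-(2 * U (ξR s) (ξθ s))) * (ξR s) ^ 2
        * derivWithin ξY (Set.Ico s₀ s₁) s = JY) ∧
  -- (iv) the θ-component of the geodesic equation
  (∀ s ∈ Set.Ico s₀ s₁,
    derivWithin (fun u => derivWithin ξθ (Set.Ico s₀ s₁) u) (Set.Ico s₀ s₁) s
      = -(pdT (fun r t => η r t - U r t) (ξR s) (ξθ s)
            * ((derivWithin ξR (Set.Ico s₀ s₁) s) ^ 2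
              + (derivWithin ξθ (Set.Ico s₀ s₁) s) ^ 2))
        - 2 * pdR (fun r t => η r t - U r t) (ξR s) (ξθ s)
            * derivWithin ξR (Set.Ico s₀ s₁) s
            * derivWithin ξθ (Set.Ico s₀ s₁) s
        + 1 / 2 * Real.exp (-(2 * (η (ξR s) (ξθ s) - U (ξR s) (ξθ s))))
          * (pdT (fun r t => Real.exp (2 * U r t)) (ξR s) (ξθ s)
                * (derivWithin ξX (Set.Ico s₀ s₁) s) ^ 2
            + 2 * pdT (fun r t => A r t * Real.exp (2 * U r t)) (ξR s) (ξθ s)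
                * derivWithin ξX (Set.Ico s₀ s₁) s
                * derivWithin ξY (Set.Ico s₀ s₁) s
            + pdT (fun r t => (A r t) ^ 2 * Real.exp (2 * U r t)
                  + r ^ 2 * Real.exp (-(2 * U r t))) (ξR s) (ξθ s)
                * (derivWithin ξY (Set.Ico s₀ s₁) s) ^ 2))

lemma alg_ineq (r a b da db E K P Q UR UT cR cT ρR ρT : ℝ) (hr : 0 < r) (ha : 0 < a) (hK : 0 < K)
    (hE : 0 < E) (h1 : a^2 - b^2 = E * (K^2 + P^2 + Q^2))
    (hρR : ρR = r * (UR^2 + UT^2 + cR^2 + cT^2) - UR)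
    (hρT : ρT = r * (2 * UR * UT + 2 * cR * cT) - UT)
    (hdb : db = -(ρT * (a^2 + b^2)) - 2 * ρR * a * b + E * (UT * (P^2 - Q^2) + 2 * cT * P * Q))
    (hda : a * da = b * db - (ρR * a + ρT * b) * (a^2 - b^2)
      + E * ((UR * a + UT * b) * (Q^2 - P^2) - Q^2 * a / r - 2 * (cR * a + cT * b) * P * Q)) :
    da * r ≤ a ^ 2 := by
  obtain ⟨u, hu⟩ : ∃ u, u = UR * a + UT * b := ⟨_, rfl⟩
  obtain ⟨v, hv⟩ : ∃ v, v = UR * b + UT * a := ⟨_, rfl⟩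
  obtain ⟨α, hα⟩ : ∃ u, u = cR * a + cT * b := ⟨_, rfl⟩
  obtain ⟨β, hβ⟩ : ∃ v, v = cR * b + cT * a := ⟨_, rfl⟩
  have e1 : da = -r * (u^2 + v^2 + α^2 + β^2) + a * u + b * v
      + E * (UR * (Q^2 - P^2) - Q^2 / r - 2 * cR * P * Q) := by
    apply mul_left_cancel₀ ha.ne'
    rw [hda, hdb, hu, hv, hα, hβ, hρR, hρT]
    ring
  obtain ⟨W, hW⟩ : ∃ W, W = K^2 + P^2 + Q^2 := ⟨_, rfl⟩
  have hWp : 0 < W := by rw [hW]; positivity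
  rw [← hW] at h1
  obtain ⟨p, hp⟩ : ∃ p, p = P^2 / W := ⟨_, rfl⟩
  obtain ⟨q, hq⟩ : ∃ p, p = Q^2 / W := ⟨_, rfl⟩
  obtain ⟨m, hm⟩ : ∃ p, p = 2 * P * Q / W := ⟨_, rfl⟩
  have hEW : E = (a^2 - b^2) / W := by rw [h1]; field_simp
  have hp0 : 0 ≤ p := by rw [hp]; positivity
  have hq0 : 0 ≤ q := by rw [hq]; positivity
  have hpq : p + q ≤ 1 := by rw [hp, hq, ← add_div, div_le_one hWp, hW]; linarith [sq_nonneg K]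
  have hmm : m^2 = 4 * p * q := by rw [hm, hp, hq]; field_simp; ring
  have hab : 0 ≤ a^2 - b^2 := by rw [h1]; positivity
  have e2 : da * r = -(r^2 * (u^2 + v^2 + α^2 + β^2)) + r * (a * u + b * v)
      + r * ((u * a - v * b) * (q - p) - m * (α * a - β * b)) - q * (a^2 - b^2) := by
    rw [e1, hEW, hp, hq, hm, hu, hv, hα, hβ]
    field_simp
    ring
  have hS : (q - p)^2 + m^2 ≤ 1 := by
    have : 0 ≤ (1 - (p + q)) * (1 + (p + q)) := mul_nonneg (by linarith) (by linarith)
    rw [hmm]; linarith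
  have k1 : 0 ≤ a^2 * (1 - ((q - p)^2 + m^2)) := mul_nonneg (sq_nonneg _) (by linarith)
  have k2 : 0 ≤ b^2 * (1 - ((q - p)^2 + m^2)) := mul_nonneg (sq_nonneg _) (by linarith)
  have k3 : 0 ≤ (p + q) * (a^2 - b^2) := mul_nonneg (by linarith) hab
  rw [e2]
  linarith [sq_nonneg (r * u - a * (1 + (q - p)) / 2), sq_nonneg (r * v - b * (1 - (q - p)) / 2),
    sq_nonneg (r * α + m * a / 2), sq_nonneg (r * β - m * b / 2)]

lemma ode_extend {E : Type*} [NormedAddCommGroup E] [NormedSpace ℝ E] [CompleteSpace E]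
    (V : E → E) (Ω : Set E) (hΩ : IsOpen Ω) (hV : ContDiffOn ℝ 1 V Ω) (s₀ s₁ : ℝ) (hs : s₀ < s₁)
    (v : ℝ → E) (hv : ∀ s ∈ Ico s₀ s₁, HasDerivWithinAt v (V (v s)) (Ico s₀ s₁) s)
    (k : Set E) (hk : IsCompact k) (hkΩ : k ⊆ Ω) (hvk : ∀ s ∈ Ico s₀ s₁, v s ∈ k) :
    ∃ s₁', s₁ < s₁' ∧ ∃ w : ℝ → E, (∀ s ∈ Ico s₀ s₁, w s = v s) ∧
      ∀ s ∈ Ico s₀ s₁', w s ∈ Ω ∧ HasDerivWithinAt w (V (w s)) (Ico s₀ s₁') s := by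
  obtain ⟨C, hC⟩ := hk.exists_bound_of_continuousOn (hV.continuousOn.mono hkΩ)
  have hlip : LipschitzOnWith C.toNNReal v (Ico s₀ s₁) :=
    (convex_Ico s₀ s₁).lipschitzOnWith_of_nnnorm_hasDerivWithin_le hv (fun x hx => by
      rw [← NNReal.coe_le_coe, coe_nnnorm]
      exact (hC _ (hvk x hx)).trans (Real.le_coe_toNNReal C))
  have hne : (nhdsWithin s₁ (Ico s₀ s₁)).NeBot := by
    rw [← mem_closure_iff_nhdsWithin_neBot, closure_Ico hs.ne]
    exact ⟨hs.le, le_rfl⟩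
  have hcau : Cauchy (nhdsWithin s₁ (Ico s₀ s₁)) := cauchy_nhds.mono inf_le_left
  have hcau2 := hcau.map_of_le hlip.uniformContinuousOn inf_le_right
  obtain ⟨v1, hv1⟩ := CompleteSpace.complete hcau2
  have hv1' : Filter.Tendsto v (nhdsWithin s₁ (Ico s₀ s₁)) (nhds v1) := hv1
  have hv1k : v1 ∈ k := hk.isClosed.mem_of_tendsto hv1'
    (by filter_upwards [self_mem_nhdsWithin] with s hs using hvk s hs)
  have hv1Ω := hkΩ hv1k
  have hVat : ContDiffAt ℝ 1 V v1 := hV.contDiffAt (hΩ.mem_nhds hv1Ω)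
  obtain ⟨ζ, hζ1, ε, hε, hζ⟩ :=
    hVat.exists_forall_mem_closedBall_exists_eq_forall_mem_Ioo_hasDerivAt₀ s₁
  have hζc : ContinuousAt ζ s₁ := (hζ s₁ ⟨by linarith, by linarith⟩).continuousAt
  have hζΩ : ∀ᶠ s in nhds s₁, ζ s ∈ Ω := hζc.eventually_mem (by rw [hζ1]; exact hΩ.mem_nhds hv1Ω)
  obtain ⟨δ, hδ, hδΩ⟩ := Metric.eventually_nhds_iff.1 hζΩ
  have hIco : Ico s₀ s₁ ∈ nhdsWithin s₁ (Iio s₁) := Ico_mem_nhdsLT hs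
  have hIoo : Ioo s₀ s₁ ∈ nhdsWithin s₁ (Iio s₁) := Ioo_mem_nhdsLT hs
  have hvl : Filter.Tendsto v (nhdsWithin s₁ (Iio s₁)) (nhds v1) :=
    hv1'.mono_left (le_inf inf_le_left (Filter.le_principal_iff.2 hIco))
  set w : ℝ → E := fun s => if s < s₁ then v s else ζ s with hw
  have hwl : ∀ s, s < s₁ → w s = v s := fun s h => if_pos h
  have hwr : ∀ s, s₁ ≤ s → w s = ζ s := fun s h => if_neg (not_lt.2 h)
  have hw1 : w s₁ = v1 := by rw [hwr _ le_rfl, hζ1]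
  have hdl : ∀ s ∈ Ioo s₀ s₁, HasDerivAt w (V (v s)) s := by
    intro s h
    have := (hv s ⟨h.1.le, h.2⟩).hasDerivAt (Ico_mem_nhds h.1 h.2)
    refine this.congr_of_eventuallyEq ?_
    filter_upwards [Iio_mem_nhds h.2] with t ht using hwl t ht
  have hd1 : HasDerivAt w (V v1) s₁ := by
    have L : HasDerivWithinAt w (V v1) (Iic s₁) s₁ := by
      refine hasDerivWithinAt_Iic_of_tendsto_deriv (s := Ioo s₀ s₁)
        (fun s h => (hdl s h).differentiableAt.differentiableWithinAt) ?_ hIoo ?_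
      · unfold ContinuousWithinAt
        rw [hw1]
        refine (hv1'.mono_left (nhdsWithin_mono _ Ioo_subset_Ico_self)).congr' ?_
        filter_upwards [self_mem_nhdsWithin] with t ht using (hwl t ht.2).symm
      · refine (hVat.continuousAt.tendsto.comp hvl).congr' ?_
        filter_upwards [hIoo] with t ht using (hdl t ht).deriv.symm
    have Rr : HasDerivWithinAt w (V v1) (Ici s₁) s₁ := by
      have := (hζ s₁ ⟨by linarith, by linarith⟩).hasDerivWithinAt (s := Ici s₁)
      rw [hζ1] at this
      exact this.congr (fun t ht => hwr t ht) (hwr _ le_rfl)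
    simpa using L.union Rr
  have hmin : 0 < min ε δ := lt_min hε hδ
  refine ⟨s₁ + min ε δ, by linarith, w, fun s h => hwl s h.2, fun s h => ?_⟩
  rcases lt_trichotomy s s₁ with h1 | h1 | h1
  · rw [hwl s h1]
    refine ⟨hkΩ (hvk s ⟨h.1, h1⟩), ?_⟩
    have := hv s ⟨h.1, h1⟩
    have h2 : HasDerivWithinAt v (V (v s)) (Ico s₀ (s₁ + min ε δ)) s := by
      refine this.mono_of_mem_nhdsWithin ?_
      filter_upwards [self_mem_nhdsWithin, mem_nhdsWithin_of_mem_nhds (Iio_mem_nhds h1)]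
        with t ht ht2 using ⟨ht.1, ht2⟩
    refine h2.congr_of_eventuallyEq ?_ (hwl s h1)
    filter_upwards [mem_nhdsWithin_of_mem_nhds (Iio_mem_nhds h1)] with t ht using hwl t ht
  · subst h1
    rw [hw1]
    exact ⟨hv1Ω, hd1.hasDerivWithinAt⟩
  · rw [hwr s h1.le]
    have hm1 := min_le_left ε δ
    have hm2 := min_le_right ε δ
    have hlt := h.2
    refine ⟨hδΩ ?_, HasDerivAt.hasDerivWithinAt ?_⟩
    · rw [Real.dist_eq, abs_of_pos (by linarith)]; linarith
    · refine (hζ s ⟨by linarith, by linarith⟩).congr_of_eventuallyEq ?_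
      filter_upwards [Ioi_mem_nhds h1] with t ht using hwr t (le_of_lt ht)

lemma ode_contDiffOn {E : Type*} [NormedAddCommGroup E] [NormedSpace ℝ E]
    (V : E → E) (Ω : Set E) (hV : ContDiffOn ℝ 1 V Ω) (s₀ s₁ : ℝ)
    (w : ℝ → E) (hw : ∀ s ∈ Ico s₀ s₁, w s ∈ Ω ∧ HasDerivWithinAt w (V (w s)) (Ico s₀ s₁) s) :
    ContDiffOn ℝ 2 w (Ico s₀ s₁) := by
  have hu := uniqueDiffOn_Ico s₀ s₁
  have hd : DifferentiableOn ℝ w (Ico s₀ s₁) := fun s h => (hw s h).2.differentiableWithinAt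
  have he : ∀ s ∈ Ico s₀ s₁, derivWithin w (Ico s₀ s₁) s = (V ∘ w) s :=
    fun s h => (hw s h).2.derivWithin (hu s h)
  have hm : MapsTo w (Ico s₀ s₁) Ω := fun s h => (hw s h).1
  have h1 : ContDiffOn ℝ 1 w (Ico s₀ s₁) := by
    rw [show (1 : WithTop ℕ∞) = 0 + 1 by norm_num, contDiffOn_succ_iff_derivWithin hu]
    refine ⟨hd, by simp, ?_⟩
    rw [contDiffOn_zero]
    exact (hV.continuousOn.comp hd.continuousOn hm).congr he
  rw [show (2 : WithTop ℕ∞) = 1 + 1 by norm_num, contDiffOn_succ_iff_derivWithin hu]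
  exact ⟨hd, by simp, (hV.comp h1 hm).congr he⟩

lemma pdT_eq (f : ℝ → ℝ → ℝ) (hf : Differentiable ℝ (Function.uncurry f)) (R θ : ℝ) :
    HasDerivAt (fun t => f R t) (fderiv ℝ (Function.uncurry f) (R, θ) (0, 1)) θ := by
  have h1 := (hf (R, θ)).hasFDerivAt
  have h2 : HasDerivAt (fun t : ℝ => (R, t)) ((0 : ℝ), (1 : ℝ)) θ :=
    (hasDerivAt_const θ R).prodMk (hasDerivAt_id θ)
  exact h1.comp_hasDerivAt θ h2

lemma pdR_eq (f : ℝ → ℝ → ℝ) (hf : Differentiable ℝ (Function.uncurry f)) (R θ : ℝ) :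
    HasDerivAt (fun r => f r θ) (fderiv ℝ (Function.uncurry f) (R, θ) (1, 0)) R := by
  have h1 := (hf (R, θ)).hasFDerivAt
  have h2 : HasDerivAt (fun r : ℝ => (r, θ)) ((1 : ℝ), (0 : ℝ)) R :=
    (hasDerivAt_id R).prodMk (hasDerivAt_const R θ)
  exact h1.comp_hasDerivAt R h2

lemma smooth_diff {f : ℝ → ℝ → ℝ} (hf : ContDiff ℝ (⊤ : ℕ∞) (Function.uncurry f)) :
    Differentiable ℝ (Function.uncurry f) := hf.differentiable (by simp)

lemma pdT_has {f : ℝ → ℝ → ℝ} (hf : ContDiff ℝ (⊤ : ℕ∞) (Function.uncurry f)) (R θ : ℝ) :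
    HasDerivAt (fun t => f R t) (pdT f R θ) θ :=
  (pdT_eq f (smooth_diff hf) R θ).differentiableAt.hasDerivAt

lemma pdR_has {f : ℝ → ℝ → ℝ} (hf : ContDiff ℝ (⊤ : ℕ∞) (Function.uncurry f)) (R θ : ℝ) :
    HasDerivAt (fun r => f r θ) (pdR f R θ) R :=
  (pdR_eq f (smooth_diff hf) R θ).differentiableAt.hasDerivAt

lemma pdT_smooth {f : ℝ → ℝ → ℝ} (hf : ContDiff ℝ (⊤ : ℕ∞) (Function.uncurry f)) :
    ContDiff ℝ 1 (Function.uncurry (pdT f)) := by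
  have h : Function.uncurry (pdT f) = fun p => fderiv ℝ (Function.uncurry f) p (0, 1) := by
    funext p
    exact (pdT_eq f (smooth_diff hf) p.1 p.2).deriv
  rw [h]
  exact (hf.fderiv_right (m := 1) (WithTop.coe_le_coe.2 (le_top : (1 + 1 : ℕ∞) ≤ ⊤))).clm_apply contDiff_const

lemma pdR_smooth {f : ℝ → ℝ → ℝ} (hf : ContDiff ℝ (⊤ : ℕ∞) (Function.uncurry f)) :
    ContDiff ℝ 1 (Function.uncurry (pdR f)) := by
  have h : Function.uncurry (pdR f) = fun p => fderiv ℝ (Function.uncurry f) p (1, 0) := by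
    funext p
    exact (pdR_eq f (smooth_diff hf) p.1 p.2).deriv
  rw [h]
  exact (hf.fderiv_right (m := 1) (WithTop.coe_le_coe.2 (le_top : (1 + 1 : ℕ∞) ≤ ⊤))).clm_apply contDiff_const

lemma chain_has {f : ℝ → ℝ → ℝ} (hf : ContDiff ℝ (⊤ : ℕ∞) (Function.uncurry f))
    {r t : ℝ → ℝ} {a b s : ℝ} {S : Set ℝ} (hr : HasDerivWithinAt r a S s)
    (ht : HasDerivWithinAt t b S s) :
    HasDerivWithinAt (fun s => f (r s) (t s))
      (pdR f (r s) (t s) * a + pdT f (r s) (t s) * b) S s := by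
  have h1 := (smooth_diff hf (r s, t s)).hasFDerivAt
  have h2 := h1.comp_hasDerivWithinAt s (hr.prodMk ht)
  have e1 : pdR f (r s) (t s) = fderiv ℝ (Function.uncurry f) (r s, t s) (1, 0) :=
    (pdR_eq f (smooth_diff hf) _ _).deriv
  have e2 : pdT f (r s) (t s) = fderiv ℝ (Function.uncurry f) (r s, t s) (0, 1) :=
    (pdT_eq f (smooth_diff hf) _ _).deriv
  have e3 : ((a, b) : ℝ × ℝ) = a • ((1 : ℝ), (0 : ℝ)) + b • ((0 : ℝ), (1 : ℝ)) := by simp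
  rw [e3, map_add, map_smul, map_smul, ← e1, ← e2] at h2
  refine h2.congr_deriv ?_
  simp only [smul_eq_mul]
  ring

section
variable {U A η : ℝ → ℝ → ℝ}

lemma sm_sub (hU : ContDiff ℝ (⊤ : ℕ∞) (Function.uncurry U))
    (hη : ContDiff ℝ (⊤ : ℕ∞) (Function.uncurry η)) :
    ContDiff ℝ (⊤ : ℕ∞) (Function.uncurry (fun r t => η r t - U r t)) := hη.sub hU

lemma sm_exp (hU : ContDiff ℝ (⊤ : ℕ∞) (Function.uncurry U)) :
    ContDiff ℝ (⊤ : ℕ∞) (Function.uncurry (fun r t => Real.exp (2 * U r t))) :=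
  (contDiff_const.mul hU).exp

lemma sm_Aexp (hU : ContDiff ℝ (⊤ : ℕ∞) (Function.uncurry U))
    (hA : ContDiff ℝ (⊤ : ℕ∞) (Function.uncurry A)) :
    ContDiff ℝ (⊤ : ℕ∞) (Function.uncurry (fun r t => A r t * Real.exp (2 * U r t))) :=
  hA.mul (sm_exp hU)

lemma sm_last (hU : ContDiff ℝ (⊤ : ℕ∞) (Function.uncurry U))
    (hA : ContDiff ℝ (⊤ : ℕ∞) (Function.uncurry A)) :
    ContDiff ℝ (⊤ : ℕ∞) (Function.uncurry (fun r t => (A r t) ^ 2 * Real.exp (2 * U r t)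
                  + r ^ 2 * Real.exp (-(2 * U r t)))) :=
  ((hA.pow 2).mul (sm_exp hU)).add ((contDiff_fst.pow 2).mul (contDiff_const.mul hU).neg.exp)

lemma pd_sub (hU : ContDiff ℝ (⊤ : ℕ∞) (Function.uncurry U))
    (hη : ContDiff ℝ (⊤ : ℕ∞) (Function.uncurry η)) (R θ : ℝ) :
    pdR (fun r t => η r t - U r t) R θ = pdR η R θ - pdR U R θ ∧
    pdT (fun r t => η r t - U r t) R θ = pdT η R θ - pdT U R θ :=
  ⟨((pdR_has hη R θ).sub (pdR_has hU R θ)).deriv, ((pdT_has hη R θ).sub (pdT_has hU R θ)).deriv⟩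

lemma pd_exp (hU : ContDiff ℝ (⊤ : ℕ∞) (Function.uncurry U)) (R θ : ℝ) :
    pdT (fun r t => Real.exp (2 * U r t)) R θ = Real.exp (2 * U R θ) * (2 * pdT U R θ) :=
  ((pdT_has hU R θ).const_mul 2).exp.deriv

lemma pd_Aexp (hU : ContDiff ℝ (⊤ : ℕ∞) (Function.uncurry U))
    (hA : ContDiff ℝ (⊤ : ℕ∞) (Function.uncurry A)) (R θ : ℝ) :
    pdT (fun r t => A r t * Real.exp (2 * U r t)) R θ = pdT A R θ * Real.exp (2 * U R θ)
      + A R θ * (Real.exp (2 * U R θ) * (2 * pdT U R θ)) :=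
  ((pdT_has hA R θ).mul ((pdT_has hU R θ).const_mul 2).exp).deriv

lemma pd_last (hU : ContDiff ℝ (⊤ : ℕ∞) (Function.uncurry U))
    (hA : ContDiff ℝ (⊤ : ℕ∞) (Function.uncurry A)) (R θ : ℝ) :
    pdT (fun r t => (A r t) ^ 2 * Real.exp (2 * U r t)
                  + r ^ 2 * Real.exp (-(2 * U r t))) R θ
      = 2 * A R θ * pdT A R θ * Real.exp (2 * U R θ)
      + A R θ ^ 2 * (Real.exp (2 * U R θ) * (2 * pdT U R θ))
      - R ^ 2 * (Real.exp (-(2 * U R θ)) * (2 * pdT U R θ)) := by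
  have h := ((((pdT_has hA R θ).pow 2).mul ((pdT_has hU R θ).const_mul 2).exp).add
    (((pdT_has hU R θ).const_mul 2).neg.exp.const_mul (R ^ 2))).deriv
  refine h.trans ?_
  simp
  ring

/-- `ξ̇^Y` as a function of position. -/
noncomputable def fY (U A : ℝ → ℝ → ℝ) (JX JY R t : ℝ) : ℝ :=
  (JY - A R t * JX) * Real.exp (2 * U R t) / R ^ 2

/-- `ξ̇^X` as a function of position. -/
noncomputable def fX (U A : ℝ → ℝ → ℝ) (JX JY R t : ℝ) : ℝ :=
  JX * Real.exp (-(2 * U R t)) - A R t * fY U A JX JY R t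

/-- `(ξ̇^R)² − (ξ̇^θ)²` as a function of position. -/
noncomputable def fF (U A η : ℝ → ℝ → ℝ) (K JX JY R t : ℝ) : ℝ :=
  Real.exp (-(2 * (η R t - U R t))) * (K ^ 2 + Real.exp (-(2 * U R t)) * JX ^ 2
    + Real.exp (2 * U R t) * (JY - A R t * JX) ^ 2 / R ^ 2)

/-- The right-hand side of (iv). -/
noncomputable def fH (U A η : ℝ → ℝ → ℝ) (R t a b x y : ℝ) : ℝ :=
  -(pdT (fun r t => η r t - U r t) R t * (a ^ 2 + b ^ 2))
        - 2 * pdR (fun r t => η r t - U r t) R t * a * b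
        + 1 / 2 * Real.exp (-(2 * (η R t - U R t)))
          * (pdT (fun r t => Real.exp (2 * U r t)) R t * x ^ 2
            + 2 * pdT (fun r t => A r t * Real.exp (2 * U r t)) R t * x * y
            + pdT (fun r t => (A r t) ^ 2 * Real.exp (2 * U r t)
                  + r ^ 2 * Real.exp (-(2 * U r t))) R t * y ^ 2)

lemma fF_pos {K : ℝ} (hK : 0 < K) (JX JY R t : ℝ) : 0 < fF U A η K JX JY R t := by
  unfold fF; positivity

/-- Equations (i)-(iii) are equivalent to the explicit first order form. -/
lemma first_order {K JX JY R t a b x y : ℝ} (hR : 0 < R) :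
    (Real.exp (2 * (η R t - U R t)) * (-a ^ 2 + b ^ 2)
      + Real.exp (2 * U R t) * (x + A R t * y) ^ 2
      + Real.exp (-(2 * U R t)) * R ^ 2 * y ^ 2 = -K ^ 2 ∧
    Real.exp (2 * U R t) * (x + A R t * y) = JX ∧
    A R t * Real.exp (2 * U R t) * (x + A R t * y) + Real.exp (-(2 * U R t)) * R ^ 2 * y = JY) ↔
    (a ^ 2 = b ^ 2 + fF U A η K JX JY R t ∧ x = fX U A JX JY R t ∧ y = fY U A JX JY R t) := by
  have hm : 0 < Real.exp (2 * U R t) := Real.exp_pos _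
  have he : 0 < Real.exp (2 * (η R t - U R t)) := Real.exp_pos _
  unfold fX fF fY
  rw [Real.exp_neg (2 * U R t), Real.exp_neg (2 * (η R t - U R t))]
  generalize Real.exp (2 * U R t) = m at *
  generalize Real.exp (2 * (η R t - U R t)) = e at *
  generalize A R t = α at *
  constructor
  · rintro ⟨h1, h2, h3⟩
    have hy : y = (JY - α * JX) * m / R ^ 2 := by
      rw [← h3, ← h2]; field_simp; ring
    have hx : x = JX * m⁻¹ - α * y := by
      rw [← h2]; field_simp; ring
    refine ⟨?_, ?_, hy⟩
    · have hz : x + α * y = JX * m⁻¹ := by rw [hx]; ring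
      rw [hz, hy] at h1
      have : a ^ 2 = b ^ 2 + e⁻¹ * (K ^ 2 + m * (JX * m⁻¹) ^ 2
        + m⁻¹ * R ^ 2 * ((JY - α * JX) * m / R ^ 2) ^ 2) := by
        field_simp
        field_simp at h1
        linarith
      rw [this]; field_simp
    · rw [← hy]; exact hx
  · rintro ⟨h1, h2, h3⟩
    rw [← h3] at h2
    have hz : x + α * y = JX * m⁻¹ := by rw [h2]; ring
    rw [hz, h1, h3]
    refine ⟨?_, ?_, ?_⟩ <;> field_simp <;> ring
end

lemma speed_ineq {U A η : ℝ → ℝ → ℝ} {K JX JY : ℝ} (hK : 0 < K)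
    (hU : ContDiff ℝ (⊤ : ℕ∞) (Function.uncurry U))
    (hA : ContDiff ℝ (⊤ : ℕ∞) (Function.uncurry A))
    (hη : ContDiff ℝ (⊤ : ℕ∞) (Function.uncurry η))
    {r t af bf : ℝ → ℝ} {da db s : ℝ} {S : Set ℝ} (hsS : s ∈ S) (hu : UniqueDiffWithinAt ℝ S s)
    (hr : HasDerivWithinAt r (af s) S s) (ht : HasDerivWithinAt t (bf s) S s)
    (ha : HasDerivWithinAt af da S s) (hb : HasDerivWithinAt bf db S s)
    (hrpos : 0 < r s) (hapos : 0 < af s)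
    (hrel : ∀ s ∈ S, af s ^ 2 = bf s ^ 2 + fF U A η K JX JY (r s) (t s))
    (hdb : db = fH U A η (r s) (t s) (af s) (bf s) (fX U A JX JY (r s) (t s))
      (fY U A JX JY (r s) (t s)))
    (conηR : pdR η (r s) (t s) = r s * ((pdR U (r s) (t s)) ^ 2 + (pdT U (r s) (t s)) ^ 2
        + exp (4 * U (r s) (t s)) / (4 * (r s) ^ 2) * ((pdR A (r s) (t s)) ^ 2
          + (pdT A (r s) (t s)) ^ 2)))
    (conηT : pdT η (r s) (t s) = r s * (2 * pdR U (r s) (t s) * pdT U (r s) (t s)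
        + exp (4 * U (r s) (t s)) / (2 * (r s) ^ 2) * (pdR A (r s) (t s) * pdT A (r s) (t s)))) :
    da * r s ≤ af s ^ 2 := by
  have cU := chain_has hU hr ht
  have cA := chain_has hA hr ht
  have cη := chain_has hη hr ht
  have h1 := ((cη.sub cU).const_mul 2).neg.exp
  have h2 := (cU.const_mul 2).neg.exp.mul_const (JX ^ 2)
  have h3 := ((cU.const_mul 2).exp.mul (((cA.mul_const JX).const_sub JY).pow 2)).div
    (hr.pow 2) (pow_ne_zero 2 hrpos.ne')
  have h4 := (hb.pow 2).add (h1.mul ((h2.const_add (K ^ 2)).add h3))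
  have h5 := ha.pow 2
  have h6 := h5.congr_of_mem (f₁ := fun s => bf s ^ 2 + fF U A η K JX JY (r s) (t s))
    (fun x hx => (hrel x hx).symm) hsS
  have h7 := hu.eq_deriv _ h6 h4
  have hrel' := hrel s hsS
  obtain ⟨e1, e2⟩ := pd_sub hU hη (r s) (t s)
  unfold fH at hdb
  rw [e1, e2, pd_exp hU, pd_Aexp hU hA, pd_last hU hA] at hdb
  unfold fX fY at hdb
  unfold fF at hrel'
  simp only [Pi.sub_apply, Pi.mul_apply, Pi.pow_apply, Pi.neg_apply, Pi.add_apply, Pi.div_apply] at h7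
  have x2 : exp (2 * U (r s) (t s)) = exp (U (r s) (t s)) ^ 2 := by
    rw [← Real.exp_nat_mul]; norm_num
  have x4 : exp (4 * U (r s) (t s)) = exp (U (r s) (t s)) ^ 4 := by
    rw [← Real.exp_nat_mul]; norm_num
  rw [Real.exp_neg (2 * U (r s) (t s)), x2] at hdb h7 hrel'
  rw [x4] at conηR conηT
  have hp : 0 < exp (U (r s) (t s)) := Real.exp_pos _
  have hE : 0 < exp (-(2 * (η (r s) (t s) - U (r s) (t s)))) := Real.exp_pos _
  generalize exp (U (r s) (t s)) = p at *
  generalize exp (-(2 * (η (r s) (t s) - U (r s) (t s)))) = E at *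
  generalize pdR U (r s) (t s) = UR at *
  generalize pdT U (r s) (t s) = UT at *
  generalize pdR A (r s) (t s) = AR at *
  generalize pdT A (r s) (t s) = AT at *
  generalize pdR η (r s) (t s) = ηR at *
  generalize pdT η (r s) (t s) = ηT at *
  generalize A (r s) (t s) = α at *
  clear h1 h2 h3 h4 h5 h6 cU cA cη e1 e2 x2 x4 hU hA hη hr ht ha hb hrel
  generalize af s = a at *
  generalize bf s = b at *
  generalize r s = R at *
  refine alg_ineq R a b da db E K (JX / p) (p * (JY - α * JX) / R) UR UT (p ^ 2 * AR / (2 * R))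
    (p ^ 2 * AT / (2 * R)) (ηR - UR) (ηT - UT) hrpos hapos hK hE ?_ ?_ ?_ ?_ ?_
  · rw [hrel']; field_simp; ring
  · rw [conηR]; field_simp; ring
  · rw [conηT]; field_simp
  · rw [hdb]; field_simp; ring
  · have hF : a ^ 2 - b ^ 2 = E * (K ^ 2 + (p ^ 2)⁻¹ * JX ^ 2 + p ^ 2 * (JY - α * JX) ^ 2 / R ^ 2) := by
      linarith
    rw [hF]
    have h8 : a * da = b * db + (2 * a * da - 2 * b * db) / 2 := by ring
    rw [h8]
    have h9 : 2 * a * da - 2 * b * db = 2 * (-((ηR - UR) * a + (ηT - UT) * b) *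
        (E * (K ^ 2 + (p ^ 2)⁻¹ * JX ^ 2 + p ^ 2 * (JY - α * JX) ^ 2 / R ^ 2)) +
      E * ((UR * a + UT * b) * ((p * (JY - α * JX) / R) ^ 2 - (JX / p) ^ 2) -
        (p * (JY - α * JX) / R) ^ 2 * a / R -
        2 * (p ^ 2 * AR / (2 * R) * a + p ^ 2 * AT / (2 * R) * b) * (JX / p) * (p * (JY - α * JX) / R))) := by
      norm_num at h7
      rw [h7]
      field_simp
      ring
    rw [h9]
    ring

/-- The first-order vector field for `(ξR, ξθ, ξX, ξY, ξ̇θ)`. -/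
noncomputable def gVF (U A η : ℝ → ℝ → ℝ) (K JX JY : ℝ) (w : ℝ × ℝ × ℝ × ℝ × ℝ) :
    ℝ × ℝ × ℝ × ℝ × ℝ :=
  (Real.sqrt (w.2.2.2.2 ^ 2 + fF U A η K JX JY w.1 w.2.1), w.2.2.2.2,
    fX U A JX JY w.1 w.2.1, fY U A JX JY w.1 w.2.1,
    fH U A η w.1 w.2.1 (Real.sqrt (w.2.2.2.2 ^ 2 + fF U A η K JX JY w.1 w.2.1)) w.2.2.2.2
      (fX U A JX JY w.1 w.2.1) (fY U A JX JY w.1 w.2.1))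

section
variable {U A η : ℝ → ℝ → ℝ} {E : Type*} [NormedAddCommGroup E] [NormedSpace ℝ E]
  {Ω : Set E} {r t : E → ℝ}

lemma comp2 {f : ℝ → ℝ → ℝ} (hf : ContDiff ℝ 1 (Function.uncurry f))
    (hr : ContDiffOn ℝ 1 r Ω) (ht : ContDiffOn ℝ 1 t Ω) :
    ContDiffOn ℝ 1 (fun w => f (r w) (t w)) Ω :=
  hf.comp_contDiffOn (hr.prodMk ht)

lemma fY_cd (JX JY : ℝ) (hU : ContDiff ℝ 1 (Function.uncurry U))
    (hA : ContDiff ℝ 1 (Function.uncurry A)) (hr : ContDiffOn ℝ 1 r Ω) (ht : ContDiffOn ℝ 1 t Ω)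
    (hpos : ∀ w ∈ Ω, 0 < r w) : ContDiffOn ℝ 1 (fun w => fY U A JX JY (r w) (t w)) Ω := by
  have u := comp2 hU hr ht
  have α := comp2 hA hr ht
  exact ((contDiffOn_const.sub (α.mul contDiffOn_const)).mul (contDiffOn_const.mul u).exp).div
    (hr.pow 2) (fun w hw => pow_ne_zero 2 (hpos w hw).ne')

lemma fX_cd (JX JY : ℝ) (hU : ContDiff ℝ 1 (Function.uncurry U))
    (hA : ContDiff ℝ 1 (Function.uncurry A)) (hr : ContDiffOn ℝ 1 r Ω) (ht : ContDiffOn ℝ 1 t Ω)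
    (hpos : ∀ w ∈ Ω, 0 < r w) : ContDiffOn ℝ 1 (fun w => fX U A JX JY (r w) (t w)) Ω := by
  have u := comp2 hU hr ht
  have α := comp2 hA hr ht
  exact (contDiffOn_const.mul (contDiffOn_const.mul u).neg.exp).sub
    (α.mul (fY_cd JX JY hU hA hr ht hpos))

lemma fF_cd (K JX JY : ℝ) (hU : ContDiff ℝ 1 (Function.uncurry U))
    (hA : ContDiff ℝ 1 (Function.uncurry A)) (hη : ContDiff ℝ 1 (Function.uncurry η))
    (hr : ContDiffOn ℝ 1 r Ω) (ht : ContDiffOn ℝ 1 t Ω)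
    (hpos : ∀ w ∈ Ω, 0 < r w) : ContDiffOn ℝ 1 (fun w => fF U A η K JX JY (r w) (t w)) Ω := by
  have u := comp2 hU hr ht
  have α := comp2 hA hr ht
  have e := comp2 hη hr ht
  exact (contDiffOn_const.mul (e.sub u)).neg.exp.mul ((contDiffOn_const.add
    ((contDiffOn_const.mul u).neg.exp.mul contDiffOn_const)).add
    (((contDiffOn_const.mul u).exp.mul ((contDiffOn_const.sub (α.mul contDiffOn_const)).pow 2)).div
    (hr.pow 2) (fun w hw => pow_ne_zero 2 (hpos w hw).ne')))

lemma fH_cd (hU : ContDiff ℝ (⊤ : ℕ∞) (Function.uncurry U))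
    (hA : ContDiff ℝ (⊤ : ℕ∞) (Function.uncurry A)) (hη : ContDiff ℝ (⊤ : ℕ∞) (Function.uncurry η))
    (hr : ContDiffOn ℝ 1 r Ω) (ht : ContDiffOn ℝ 1 t Ω) {a b x y : E → ℝ}
    (ha : ContDiffOn ℝ 1 a Ω) (hb : ContDiffOn ℝ 1 b Ω) (hx : ContDiffOn ℝ 1 x Ω)
    (hy : ContDiffOn ℝ 1 y Ω) :
    ContDiffOn ℝ 1 (fun w => fH U A η (r w) (t w) (a w) (b w) (x w) (y w)) Ω := by
  have h1 := comp2 (pdT_smooth (sm_sub hU hη)) hr ht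
  have h2 := comp2 (pdR_smooth (sm_sub hU hη)) hr ht
  have h3 := comp2 (pdT_smooth (sm_exp hU)) hr ht
  have h4 := comp2 (pdT_smooth (sm_Aexp hU hA)) hr ht
  have h5 := comp2 (pdT_smooth (sm_last hU hA)) hr ht
  have u := comp2 (hU.of_le (by exact_mod_cast le_top)) hr ht
  have e := comp2 (hη.of_le (by exact_mod_cast le_top)) hr ht
  exact (((h1.mul ((ha.pow 2).add (hb.pow 2))).neg).sub
    (((contDiffOn_const.mul h2).mul ha).mul hb)).add
    ((contDiffOn_const.mul (contDiffOn_const.mul (e.sub u)).neg.exp).mul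
      (((h3.mul (hx.pow 2)).add (((contDiffOn_const.mul h4).mul hx).mul hy)).add
        (h5.mul (hy.pow 2))))
end

lemma gVF_cd {U A η : ℝ → ℝ → ℝ} {K : ℝ} (hK : 0 < K) (JX JY : ℝ)
    (hU : ContDiff ℝ (⊤ : ℕ∞) (Function.uncurry U))
    (hA : ContDiff ℝ (⊤ : ℕ∞) (Function.uncurry A))
    (hη : ContDiff ℝ (⊤ : ℕ∞) (Function.uncurry η)) :
    ContDiffOn ℝ 1 (gVF U A η K JX JY) {w | 0 < w.1} := by
  have hU1 : ContDiff ℝ 1 (Function.uncurry U) := hU.of_le (by exact_mod_cast le_top)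
  have hA1 : ContDiff ℝ 1 (Function.uncurry A) := hA.of_le (by exact_mod_cast le_top)
  have hη1 : ContDiff ℝ 1 (Function.uncurry η) := hη.of_le (by exact_mod_cast le_top)
  have hr : ContDiffOn ℝ 1 (fun w : ℝ × ℝ × ℝ × ℝ × ℝ => w.1) {w | 0 < w.1} := by fun_prop
  have ht : ContDiffOn ℝ 1 (fun w : ℝ × ℝ × ℝ × ℝ × ℝ => w.2.1) {w | 0 < w.1} := by fun_prop
  have hb : ContDiffOn ℝ 1 (fun w : ℝ × ℝ × ℝ × ℝ × ℝ => w.2.2.2.2) {w | 0 < w.1} := by fun_prop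
  have hp : ∀ w ∈ {w : ℝ × ℝ × ℝ × ℝ × ℝ | 0 < w.1}, 0 < w.1 := fun w h => h
  have hF := fF_cd K JX JY hU1 hA1 hη1 hr ht hp
  have hX := fX_cd JX JY hU1 hA1 hr ht hp
  have hY := fY_cd JX JY hU1 hA1 hr ht hp
  have ha := ((hb.pow 2).add hF).sqrt (fun w hw => by
    have := fF_pos (U := U) (A := A) (η := η) hK JX JY w.1 w.2.1
    positivity)
  exact ha.prodMk (hb.prodMk (hX.prodMk (hY.prodMk (fH_cd hU hA hη hr ht ha hb hX hY))))

lemma gVF_geo {U A η : ℝ → ℝ → ℝ} {R₀ K : ℝ} (hK : 0 < K) (JX JY : ℝ)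
    (hU : ContDiff ℝ (⊤ : ℕ∞) (Function.uncurry U))
    (hA : ContDiff ℝ (⊤ : ℕ∞) (Function.uncurry A))
    (hη : ContDiff ℝ (⊤ : ℕ∞) (Function.uncurry η)) (s₀ s₁ : ℝ) (hs : s₀ < s₁)
    (w : ℝ → ℝ × ℝ × ℝ × ℝ × ℝ) (hw0 : R₀ ≤ (w s₀).1)
    (hw : ∀ s ∈ Ico s₀ s₁, w s ∈ {w : ℝ × ℝ × ℝ × ℝ × ℝ | 0 < w.1} ∧
      HasDerivWithinAt w (gVF U A η K JX JY (w s)) (Ico s₀ s₁) s) :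
    IsGowdyGeodesic R₀ U A η K JX JY s₀ s₁ (fun s => (w s).1) (fun s => (w s).2.1)
      (fun s => (w s).2.2.1) (fun s => (w s).2.2.2.1) := by
  have hu := uniqueDiffOn_Ico s₀ s₁
  have hc := ode_contDiffOn _ _ (gVF_cd hK JX JY hU hA hη) s₀ s₁ w hw
  have d1 : ∀ s ∈ Ico s₀ s₁, HasDerivWithinAt (fun s => (w s).1) _ (Ico s₀ s₁) s :=
    fun s h => (hw s h).2.fst
  have d2 : ∀ s ∈ Ico s₀ s₁, HasDerivWithinAt (fun s => (w s).2.1) _ (Ico s₀ s₁) s :=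
    fun s h => (hw s h).2.snd.fst
  have d3 : ∀ s ∈ Ico s₀ s₁, HasDerivWithinAt (fun s => (w s).2.2.1) _ (Ico s₀ s₁) s :=
    fun s h => (hw s h).2.snd.snd.fst
  have d4 : ∀ s ∈ Ico s₀ s₁, HasDerivWithinAt (fun s => (w s).2.2.2.1) _ (Ico s₀ s₁) s :=
    fun s h => (hw s h).2.snd.snd.snd.fst
  have d5 : ∀ s ∈ Ico s₀ s₁, HasDerivWithinAt (fun s => (w s).2.2.2.2) _ (Ico s₀ s₁) s :=
    fun s h => (hw s h).2.snd.snd.snd.snd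
  have e1 := fun s h => (d1 s h).derivWithin (hu s h)
  have e2 := fun s h => (d2 s h).derivWithin (hu s h)
  have e3 := fun s h => (d3 s h).derivWithin (hu s h)
  have e4 := fun s h => (d4 s h).derivWithin (hu s h)
  have e5 := fun s h => (d5 s h).derivWithin (hu s h)
  have key : ∀ s (h : s ∈ Ico s₀ s₁), _ := fun s h => (first_order (U := U) (A := A) (η := η)
    (K := K) (JX := JX) (JY := JY) (R := (w s).1) (t := (w s).2.1)
    (a := (gVF U A η K JX JY (w s)).1) (b := (gVF U A η K JX JY (w s)).2.1)
    (x := (gVF U A η K JX JY (w s)).2.2.1) (y := (gVF U A η K JX JY (w s)).2.2.2.1) (hw s h).1).2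
    ⟨Real.sq_sqrt (by
      have := fF_pos (U := U) (A := A) (η := η) hK JX JY (w s).1 (w s).2.1
      positivity), rfl, rfl⟩
  refine ⟨hc.fst, hc.snd.fst, hc.snd.snd.fst, hc.snd.snd.snd.fst, ?_, ?_, ?_, ?_, ?_⟩
  · have hmono : MonotoneOn (fun s => (w s).1) (Ico s₀ s₁) := by
      refine monotoneOn_of_hasDerivWithinAt_nonneg (convex_Ico _ _) hc.fst.continuousOn
        (fun x hx => (d1 x (interior_subset hx)).mono interior_subset) ?_
      intro x hx
      exact Real.sqrt_nonneg _
    intro s h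
    exact hw0.trans (hmono ⟨le_rfl, hs⟩ h h.1)
  · intro s h
    rw [e1 s h, e2 s h, e3 s h, e4 s h]
    exact (key s h).1
  · intro s h
    rw [e3 s h, e4 s h]
    exact (key s h).2.1
  · intro s h
    rw [e3 s h, e4 s h]
    exact (key s h).2.2
  · intro s h
    rw [derivWithin_congr (f := fun s => (w s).2.2.2.2) (fun u hu => e2 u hu) (e2 s h), e5 s h,
      e1 s h, e2 s h, e3 s h, e4 s h]
    rfl

lemma drift {f f' : ℝ → ℝ} {s₀ s₁ C : ℝ} (hs : s₀ < s₁)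
    (hf : ∀ s ∈ Ico s₀ s₁, HasDerivWithinAt f (f' s) (Ico s₀ s₁) s)
    (hC : ∀ s ∈ Ico s₀ s₁, |f' s| ≤ C) : ∀ s ∈ Ico s₀ s₁,
    f s ∈ Icc (f s₀ - C * (s₁ - s₀)) (f s₀ + C * (s₁ - s₀)) := by
  intro s h
  have h0 : s₀ ∈ Ico s₀ s₁ := ⟨le_rfl, hs⟩
  have hC0 : 0 ≤ C := (abs_nonneg _).trans (hC s₀ h0)
  have := (convex_Ico s₀ s₁).norm_image_sub_le_of_norm_hasDerivWithin_le hf hC h0 h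
  rw [Real.norm_eq_abs, Real.norm_eq_abs, abs_of_nonneg (sub_nonneg.2 h.1)] at this
  have h2 : C * (s - s₀) ≤ C * (s₁ - s₀) := mul_le_mul_of_nonneg_left (by linarith [h.2]) hC0
  have h3 := abs_le.1 (this.trans h2)
  constructor <;> linarith [h3.1, h3.2]

theorem stmt19
    (R₀ : ℝ) (hR₀ : 0 < R₀)
    (U A : ℝ → ℝ → ℝ)
    (hU : ContDiff ℝ (⊤ : ℕ∞) (Function.uncurry U))
    (hA : ContDiff ℝ (⊤ : ℕ∞) (Function.uncurry A))
    (hUper : ∀ R θ, U R (θ + 2 * π) = U R θ)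
    (hAper : ∀ R θ, A R (θ + 2 * π) = A R θ)
    (eqU : ∀ R, R₀ ≤ R → ∀ θ : ℝ,
      deriv (fun r => r * pdR U r θ) R - deriv (fun t => R * pdT U R t) θ
        = exp (4 * U R θ) / (2 * R) * ((pdR A R θ) ^ 2 - (pdT A R θ) ^ 2))
    (eqA : ∀ R, R₀ ≤ R → ∀ θ : ℝ,
      deriv (fun r => r⁻¹ * pdR A r θ) R - deriv (fun t => R⁻¹ * pdT A R t) θ
        = 4 / R * (-(pdR U R θ * pdR A R θ) + pdT U R θ * pdT A R θ))
    (η : ℝ → ℝ → ℝ)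
    (hη : ContDiff ℝ (⊤ : ℕ∞) (Function.uncurry η))
    (hηper : ∀ R θ, η R (θ + 2 * π) = η R θ)
    (conηR : ∀ R, R₀ ≤ R → ∀ θ : ℝ,
      pdR η R θ = R * ((pdR U R θ) ^ 2 + (pdT U R θ) ^ 2
        + exp (4 * U R θ) / (4 * R ^ 2) * ((pdR A R θ) ^ 2 + (pdT A R θ) ^ 2)))
    (conηT : ∀ R, R₀ ≤ R → ∀ θ : ℝ,
      pdT η R θ = R * (2 * pdR U R θ * pdT U R θ
        + exp (4 * U R θ) / (2 * R ^ 2) * (pdR A R θ * pdT A R θ)))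
    (K JX JY : ℝ) (hK : 0 < K)
    (s₀ s₁ : ℝ) (hs : s₀ < s₁)
    (ξR ξθ ξX ξY : ℝ → ℝ)
    (hgeo : IsGowdyGeodesic R₀ U A η K JX JY s₀ s₁ ξR ξθ ξX ξY)
    (hfut : 0 < derivWithin ξR (Set.Ico s₀ s₁) s₀)
    (hmax : ¬ ∃ s₁' : ℝ, s₁ < s₁' ∧ ∃ ξR' ξθ' ξX' ξY' : ℝ → ℝ,
      IsGowdyGeodesic R₀ U A η K JX JY s₀ s₁' ξR' ξθ' ξX' ξY'
      ∧ ∀ s ∈ Set.Ico s₀ s₁,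
          ξR' s = ξR s ∧ ξθ' s = ξθ s ∧ ξX' s = ξX s ∧ ξY' s = ξY s) :
    False := by
  classical
  obtain ⟨cR, cθ, cX, cY, hRge, g1, g2, g3, g4⟩ := hgeo
  have hu := uniqueDiffOn_Ico s₀ s₁
  have h0 : s₀ ∈ Ico s₀ s₁ := ⟨le_rfl, hs⟩
  have hRpos : ∀ s ∈ Ico s₀ s₁, 0 < ξR s := fun s h => hR₀.trans_le (hRge s h)
  have fo := fun s (h : s ∈ Ico s₀ s₁) =>
    (first_order (U := U) (A := A) (η := η) (hRpos s h)).1 ⟨g1 s h, g2 s h, g3 s h⟩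
  have dd : ∀ f : ℝ → ℝ, ContDiffOn ℝ 2 f (Ico s₀ s₁) → ∀ s ∈ Ico s₀ s₁,
      HasDerivWithinAt f (derivWithin f (Ico s₀ s₁) s) (Ico s₀ s₁) s := fun f hf s h =>
    (hf.differentiableOn (by norm_num) s h).hasDerivWithinAt
  have dd2 : ∀ f : ℝ → ℝ, ContDiffOn ℝ 2 f (Ico s₀ s₁) →
      ContDiffOn ℝ 1 (derivWithin f (Ico s₀ s₁)) (Ico s₀ s₁) := fun f hf =>
    hf.derivWithin hu (by norm_num)
  have dR := dd _ cR
  have dθ := dd _ cθ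
  have dX := dd _ cX
  have dY := dd _ cY
  have ca := dd2 _ cR
  have cb := dd2 _ cθ
  generalize derivWithin ξR (Ico s₀ s₁) = a at *
  generalize derivWithin ξθ (Ico s₀ s₁) = b at *
  have da := fun s h => (ca.differentiableOn (by norm_num) s h).hasDerivWithinAt
  have db := fun s h => (cb.differentiableOn (by norm_num) s h).hasDerivWithinAt
  have hdb : ∀ s ∈ Ico s₀ s₁, derivWithin b (Ico s₀ s₁) s
      = fH U A η (ξR s) (ξθ s) (a s) (b s) (fX U A JX JY (ξR s) (ξθ s))
        (fY U A JX JY (ξR s) (ξθ s)) := by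
    intro s h
    rw [← (fo s h).2.1, ← (fo s h).2.2]
    exact g4 s h
  have apos : ∀ s ∈ Ico s₀ s₁, 0 < a s := by
    intro s h
    by_contra hc
    obtain ⟨z, hz, hz0⟩ := isPreconnected_Ico.intermediate_value h h0 ca.continuousOn
      (show (0 : ℝ) ∈ Icc (a s) (a s₀) from ⟨not_lt.1 hc, hfut.le⟩)
    have h1 := (fo z hz).1
    have h2 := fF_pos (U := U) (A := A) (η := η) hK JX JY (ξR z) (ξθ z)
    rw [hz0] at h1
    nlinarith [sq_nonneg (b z)]
  have hba : ∀ s ∈ Ico s₀ s₁, |b s| ≤ a s := by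
    intro s h
    refine abs_le_of_sq_le_sq ?_ (apos s h).le
    have h2 := fF_pos (U := U) (A := A) (η := η) hK JX JY (ξR s) (ξθ s)
    linarith [(fo s h).1]
  have ineq : ∀ s ∈ Ico s₀ s₁, derivWithin a (Ico s₀ s₁) s * ξR s ≤ a s ^ 2 := fun s h =>
    speed_ineq hK hU hA hη h (hu s h) (dR s h) (dθ s h) (da s h) (db s h) (hRpos s h) (apos s h)
      (fun s h => (fo s h).1) (hdb s h) (conηR _ (hRge s h) _) (conηT _ (hRge s h) _)
  -- `a / R` is nonincreasing
  have anti : AntitoneOn (fun s => a s / ξR s) (Ico s₀ s₁) := by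
    refine antitoneOn_of_hasDerivWithinAt_nonpos (convex_Ico _ _)
      (ca.continuousOn.div cR.continuousOn (fun s h => (hRpos s h).ne'))
      (fun x hx => ((da x (interior_subset hx)).div (dR x (interior_subset hx))
        (hRpos x (interior_subset hx)).ne').mono interior_subset) ?_
    intro x hx
    have := ineq x (interior_subset hx)
    apply div_nonpos_of_nonpos_of_nonneg _ (sq_nonneg _)
    nlinarith
  obtain ⟨C, hC⟩ : ∃ C, C = a s₀ / ξR s₀ := ⟨_, rfl⟩
  have hCpos : 0 < C := by rw [hC]; exact div_pos (apos _ h0) (hRpos _ h0)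
  have aC : ∀ s ∈ Ico s₀ s₁, a s ≤ C * ξR s := by
    intro s h
    have := anti h0 h h.1
    simp only [← hC] at this
    exact (div_le_iff₀ (hRpos s h)).1 this
  have anti2 : AntitoneOn (fun s => ξR s * Real.exp (-(C * s))) (Ico s₀ s₁) := by
    have hE : ∀ s, HasDerivAt (fun s => Real.exp (-(C * s))) (Real.exp (-(C * s)) * -(C * 1)) s :=
      fun s => ((hasDerivAt_id s).const_mul C).neg.exp
    refine antitoneOn_of_hasDerivWithinAt_nonpos (convex_Ico _ _)
      (cR.continuousOn.mul (by fun_prop))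
      (fun x hx => ((dR x (interior_subset hx)).mul (hE x).hasDerivWithinAt).mono
        interior_subset) ?_
    intro x hx
    have := aC x (interior_subset hx)
    have h2 := Real.exp_pos (-(C * x))
    have h3 : 0 ≤ Real.exp (-(C * x)) * (C * ξR x - a x) := mul_nonneg h2.le (by linarith)
    linarith
  obtain ⟨M, hM⟩ : ∃ M, M = ξR s₀ * Real.exp (C * (s₁ - s₀)) := ⟨_, rfl⟩
  have RM : ∀ s ∈ Ico s₀ s₁, ξR s ≤ M := by
    intro s h
    have h1 := anti2 h0 h h.1
    simp only at h1
    have h2 := mul_le_mul_of_nonneg_right h1 (Real.exp_pos (C * s)).le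
    rw [mul_assoc, mul_assoc, ← Real.exp_add, ← Real.exp_add, neg_add_cancel, Real.exp_zero,
      mul_one] at h2
    rw [hM]
    refine h2.trans (mul_le_mul_of_nonneg_left (Real.exp_le_exp.2 ?_) (hRpos _ h0).le)
    nlinarith [h.2]
  have aN : ∀ s ∈ Ico s₀ s₁, a s ≤ C * M := fun s h =>
    (aC s h).trans (mul_le_mul_of_nonneg_left (RM s h) hCpos.le)
  have bN : ∀ s ∈ Ico s₀ s₁, |b s| ≤ C * M := fun s h => (hba s h).trans (aN s h)
  have boxθ := drift hs dθ bN
  generalize ξθ s₀ - C * M * (s₁ - s₀) = t1 at boxθ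
  generalize ξθ s₀ + C * M * (s₁ - s₀) = t2 at boxθ
  have hU1 : ContDiff ℝ 1 (Function.uncurry U) := hU.of_le (by exact_mod_cast le_top)
  have hA1 : ContDiff ℝ 1 (Function.uncurry A) := hA.of_le (by exact_mod_cast le_top)
  have hcomp : IsCompact (Icc R₀ M ×ˢ Icc t1 t2) := isCompact_Icc.prod isCompact_Icc
  have hpb : ∀ p ∈ Icc R₀ M ×ˢ Icc t1 t2, 0 < p.1 := fun p hp => hR₀.trans_le hp.1.1
  obtain ⟨BX, hBX⟩ := hcomp.exists_bound_of_continuousOn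
    (fX_cd JX JY hU1 hA1 contDiff_fst.contDiffOn contDiff_snd.contDiffOn hpb).continuousOn
  obtain ⟨BY, hBY⟩ := hcomp.exists_bound_of_continuousOn
    (fY_cd JX JY hU1 hA1 contDiff_fst.contDiffOn contDiff_snd.contDiffOn hpb).continuousOn
  have hin : ∀ s ∈ Ico s₀ s₁, (ξR s, ξθ s) ∈ Icc R₀ M ×ˢ Icc t1 t2 := fun s h =>
    ⟨⟨hRge s h, RM s h⟩, boxθ s h⟩
  have boxX := drift hs dX (C := BX) (fun s h => by
    rw [(fo s h).2.1]; exact hBX _ (hin s h))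
  have boxY := drift hs dY (C := BY) (fun s h => by
    rw [(fo s h).2.2]; exact hBY _ (hin s h))
  obtain ⟨s₁', hs', w, hwv, hw⟩ := ode_extend (gVF U A η K JX JY) {w | 0 < w.1}
    (isOpen_lt continuous_const continuous_fst) (gVF_cd hK JX JY hU hA hη) s₀ s₁ hs
    (fun s => (ξR s, ξθ s, ξX s, ξY s, b s))
    (by
      intro s h
      have e := (dR s h).prodMk ((dθ s h).prodMk ((dX s h).prodMk ((dY s h).prodMk (db s h))))
      refine e.congr_deriv ?_
      have hsq : Real.sqrt (b s ^ 2 + fF U A η K JX JY (ξR s) (ξθ s)) = a s := by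
        rw [← (fo s h).1, Real.sqrt_sq (apos s h).le]
      simp only [gVF, hsq]
      rw [hdb s h, (fo s h).2.1, (fo s h).2.2])
    (Icc R₀ M ×ˢ (Icc t1 t2 ×ˢ ((Icc (ξX s₀ - BX * (s₁ - s₀)) (ξX s₀ + BX * (s₁ - s₀))) ×ˢ
      ((Icc (ξY s₀ - BY * (s₁ - s₀)) (ξY s₀ + BY * (s₁ - s₀))) ×ˢ Icc (-(C * M)) (C * M)))))
    (isCompact_Icc.prod (isCompact_Icc.prod (isCompact_Icc.prod
      (isCompact_Icc.prod isCompact_Icc))))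
    (fun p hp => hR₀.trans_le hp.1.1)
    (fun s h => ⟨⟨hRge s h, RM s h⟩, boxθ s h, boxX s h, boxY s h, abs_le.1 (bN s h)⟩)
  refine hmax ⟨s₁', hs', _, _, _, _, gVF_geo hK JX JY hU hA hη s₀ s₁' (hs.trans hs') w ?_ hw,
    fun s h => ?_⟩
  · rw [hwv s₀ h0]; exact hRge s₀ h0
  · simp [hwv s h]
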